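/- arXiv:2401.13368 — 4 statements merged into one kernel-verified Lean document; each statement's English description precedes it below -/
import Mathlib

section
/- For all complex numbers A, B, A′, B′ satisfying A² + B² = A′² + B′², the equality ∫_{−π}^{π} exp(A·cos θ + B·sin θ) dθ = ∫_{−π}^{π} exp(A′·cos θ + B′·sin θ) dθ holds, i.e. the integral ∫_{−π}^{π} exp(A·cos θ + B·sin θ) dθ depends on (A, B) ∈ ℂ² only through A² + B². -/
open Real
open scoped BigOperators

theorem integral_exp_mul_circleMap_mul_inv_pow (p : ℂ) (n : ℕ) :
    ∫ θ in (0 : ℝ)..2 * π, Complex.exp (p * circleMap 0 1 θ) * (circleMap 0 1 θ)⁻¹ ^ n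
      = 2 * π / n.factorial * p ^ n := by
  have hd : DifferentiableOn ℂ (fun z : ℂ => Complex.exp (p * z)) (Metric.closedBall 0 1) := by
    fun_prop
  have key := hd.circleIntegral_one_div_sub_center_pow_smul one_pos n
  rw [iteratedDeriv_cexp_const_mul, circleIntegral] at key
  have hcongr : ∀ θ : ℝ, deriv (circleMap 0 1) θ • ((1 / (circleMap 0 1 θ - 0) ^ (n + 1)) •
      Complex.exp (p * circleMap 0 1 θ))
      = Complex.I * (Complex.exp (p * circleMap 0 1 θ) * (circleMap 0 1 θ)⁻¹ ^ n) := by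
    intro θ
    have hz : circleMap 0 1 θ ≠ 0 := circleMap_ne_center one_ne_zero
    rw [deriv_circleMap]
    simp only [smul_eq_mul, sub_zero]
    rw [inv_pow, pow_succ]
    field_simp
  simp only [hcongr, intervalIntegral.integral_const_mul] at key
  refine mul_left_cancel₀ Complex.I_ne_zero (key.trans ?_)
  simp only [smul_eq_mul, mul_zero, Complex.exp_zero]
  ring

/-- The series is that of `2π I₀(2√(p q))`, with `I₀` the modified Bessel function. -/
theorem hasSum_integral_exp_circleMap (p q : ℂ) :
    HasSum (fun n : ℕ => 2 * π * (p * q) ^ n / (n.factorial : ℂ) ^ 2)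
      (∫ θ in (0 : ℝ)..2 * π,
        Complex.exp (p * circleMap 0 1 θ + q * (circleMap 0 1 θ)⁻¹)) := by
  have hc : Continuous (circleMap 0 1) := continuous_circleMap 0 1
  have hz : ∀ θ, circleMap 0 1 θ ≠ 0 := fun θ => circleMap_ne_center one_ne_zero
  have hnorm : ∀ θ, ‖circleMap 0 1 θ‖ = 1 := by simp
  have hexp : ∀ w : ℂ, HasSum (fun n : ℕ => w ^ n / n.factorial) (Complex.exp w) := fun w => by
    rw [Complex.exp_eq_exp_ℂ]
    exact NormedSpace.expSeries_div_hasSum_exp w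
  have hsum := intervalIntegral.hasSum_integral_of_dominated_convergence
    (μ := MeasureTheory.volume) (a := 0) (b := 2 * π)
    (F := fun (n : ℕ) θ => Complex.exp (p * circleMap 0 1 θ) *
      ((q * (circleMap 0 1 θ)⁻¹) ^ n / n.factorial))
    (f := fun θ => Complex.exp (p * circleMap 0 1 θ + q * (circleMap 0 1 θ)⁻¹))
    (fun n _ => Real.exp ‖p‖ * (‖q‖ ^ n / n.factorial))
    (fun n => by
      have : Continuous fun θ => (circleMap 0 1 θ)⁻¹ := hc.inv₀ hz
      exact Continuous.aestronglyMeasurable (by fun_prop))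
    (fun n => Filter.Eventually.of_forall fun θ _ => by
      have h1 : ‖Complex.exp (p * circleMap 0 1 θ)‖ ≤ Real.exp ‖p‖ := by
        refine (Complex.norm_exp_le_exp_norm _).trans ?_
        rw [norm_mul, hnorm, mul_one]
      rw [norm_mul, norm_div, norm_pow, norm_mul, norm_inv, hnorm, inv_one, mul_one,
        Complex.norm_natCast]
      gcongr)
    (Filter.Eventually.of_forall fun θ _ =>
      (Real.summable_pow_div_factorial ‖q‖).mul_left _)
    intervalIntegrable_const
    (Filter.Eventually.of_forall fun θ _ => by
      rw [Complex.exp_add]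
      exact (hexp _).mul_left _)
  refine hsum.congr_fun fun n => ?_
  have hcongr : ∀ θ : ℝ, Complex.exp (p * circleMap 0 1 θ) *
      ((q * (circleMap 0 1 θ)⁻¹) ^ n / n.factorial) = q ^ n / n.factorial *
      (Complex.exp (p * circleMap 0 1 θ) * (circleMap 0 1 θ)⁻¹ ^ n) := fun θ => by ring
  simp only [hcongr, intervalIntegral.integral_const_mul,
    integral_exp_mul_circleMap_mul_inv_pow]
  ring

theorem integral_exp_cos_add_sin_eq_circleMap (A B : ℂ) :
    (∫ θ in (-π)..π, Complex.exp (A * Real.cos θ + B * Real.sin θ))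
      = ∫ θ in (0 : ℝ)..2 * π, Complex.exp ((A - B * Complex.I) / 2 * circleMap 0 1 θ
          + (A + B * Complex.I) / 2 * (circleMap 0 1 θ)⁻¹) := by
  have hper : Function.Periodic
      (fun θ : ℝ => Complex.exp (A * Real.cos θ + B * Real.sin θ)) (2 * π) := fun θ => by
    simp only [Real.cos_add_two_pi, Real.sin_add_two_pi]
  have hshift := hper.intervalIntegral_add_eq (-π) 0
  rw [show -π + 2 * π = π by ring, zero_add] at hshift
  rw [hshift]
  congr 1 with θ
  congr 1
  have hz : circleMap 0 1 θ = Complex.cos θ + Complex.sin θ * Complex.I := by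
    simp [circleMap, Complex.exp_mul_I]
  have hzi : (circleMap 0 1 θ)⁻¹ = Complex.cos θ - Complex.sin θ * Complex.I := by
    rw [hz]
    refine inv_eq_of_mul_eq_one_right ?_
    linear_combination Complex.sin_sq_add_cos_sq (θ : ℂ) - Complex.sin θ ^ 2 * Complex.I_sq
  rw [hzi, hz, Complex.ofReal_cos, Complex.ofReal_sin]
  linear_combination B * Complex.sin θ * Complex.I_sq

/-- The integral `∫_{−π}^{π} exp(A·cos θ + B·sin θ) dθ` of a
complex-valued function of a real variable depends on `(A, B) ∈ ℂ²` only
through `A² + B²`. -/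
theorem stmt_6
    (A B A' B' : ℂ) (h : A ^ 2 + B ^ 2 = A' ^ 2 + B' ^ 2) :
    (∫ θ in (-π)..π, Complex.exp (A * Real.cos θ + B * Real.sin θ))
      = ∫ θ in (-π)..π, Complex.exp (A' * Real.cos θ + B' * Real.sin θ) := by
  rw [integral_exp_cos_add_sin_eq_circleMap, integral_exp_cos_add_sin_eq_circleMap]
  refine (hasSum_integral_exp_circleMap _ _).unique ?_
  have hpq : (A - B * Complex.I) / 2 * ((A + B * Complex.I) / 2)
      = (A' - B' * Complex.I) / 2 * ((A' + B' * Complex.I) / 2) := by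
    linear_combination h / 4 + (B' ^ 2 - B ^ 2) / 4 * Complex.I_sq
  rw [hpq]
  exact hasSum_integral_exp_circleMap _ _
end

section
/- Let a, κ, γ, θ_c be real numbers and let w be any complex number with w² = κ² − a² − 2·i·a·κ·cos(γ − θ_c). Then ∫_{−π}^{π} exp(−i·a·cos(γ − θ) + κ·cos(θ − θ_c)) dθ = ∫_{−π}^{π} exp(w·sin t) dt. -/
open Real
open scoped BigOperators

/-- The `n`-th Fourier coefficient of `exp (P e^{iθ})`. -/
theorem integral_exp_mul_exp_neg_pow (P : ℂ) (n : ℕ) :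
    (∫ θ in (0 : ℝ)..2 * π, Complex.exp (P * Complex.exp (θ * Complex.I))
        * Complex.exp (-(θ * Complex.I)) ^ n)
      = 2 * π * P ^ n / n.factorial := by
  have hd : Differentiable ℂ fun z : ℂ => Complex.exp (P * z) := by fun_prop
  have h := hd.differentiableOn.circleIntegral_one_div_sub_center_pow_smul
    (c := 0) one_pos n
  rw [iteratedDeriv_cexp_const_mul] at h
  simp only [circleIntegral, deriv_circleMap, circleMap_zero, sub_zero, smul_eq_mul,
    Complex.ofReal_one, one_mul, mul_zero, Complex.exp_zero, mul_one] at h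
  apply mul_left_cancel₀ Complex.I_ne_zero
  rw [← intervalIntegral.integral_const_mul]
  refine Eq.trans (intervalIntegral.integral_congr fun θ _ => ?_) (h.trans (by ring))
  have := Complex.exp_ne_zero (θ * Complex.I)
  rw [Complex.exp_neg, inv_pow, pow_succ]
  field_simp

/-- The integral of `exp (P e^{iθ} + Q e^{-iθ})` over a period, expanded in powers of `P * Q`. -/
theorem hasSum_integral_exp_add (P Q : ℂ) :
    HasSum (fun n : ℕ => 2 * π * (P * Q) ^ n / (n.factorial : ℂ) ^ 2)
      (∫ θ in (0 : ℝ)..2 * π, Complex.exp (P * Complex.exp (θ * Complex.I)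
        + Q * Complex.exp (-(θ * Complex.I)))) := by
  have key := intervalIntegral.hasSum_integral_of_dominated_convergence
    (μ := MeasureTheory.volume) (a := 0) (b := 2 * π)
    (F := fun (n : ℕ) (θ : ℝ) => Q ^ n / n.factorial *
      (Complex.exp (P * Complex.exp (θ * Complex.I)) * Complex.exp (-(θ * Complex.I)) ^ n))
    (f := fun θ : ℝ => Complex.exp (P * Complex.exp (θ * Complex.I)
        + Q * Complex.exp (-(θ * Complex.I))))
    (fun n _ => ‖Q‖ ^ n / n.factorial * Real.exp ‖P‖)
    (fun n => Continuous.aestronglyMeasurable (by fun_prop)) ?_ ?_ ?_ ?_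
  · refine (congrArg (HasSum · _) (funext fun n => ?_)).mp key
    rw [intervalIntegral.integral_const_mul, integral_exp_mul_exp_neg_pow]
    ring
  · refine fun n => .of_forall fun θ _ => ?_
    have h1 : ‖Complex.exp (-(θ * Complex.I))‖ = 1 := by
      simpa using Complex.norm_exp_ofReal_mul_I (-θ)
    have h2 : ‖Complex.exp (P * Complex.exp (θ * Complex.I))‖ ≤ Real.exp ‖P‖ := by
      simpa using Complex.norm_exp_le_exp_norm (P * Complex.exp (θ * Complex.I))
    rw [norm_mul, norm_mul, norm_pow, h1, norm_div, norm_pow, Complex.norm_natCast, one_pow,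
      mul_one]
    gcongr
  · exact .of_forall fun θ _ => (Real.summable_pow_div_factorial ‖Q‖).mul_right _
  · exact intervalIntegrable_const
  · refine .of_forall fun θ _ => ?_
    have h := (NormedSpace.expSeries_div_hasSum_exp (𝔸 := ℂ)
      (Q * Complex.exp (-(θ * Complex.I)))).mul_left
        (Complex.exp (P * Complex.exp (θ * Complex.I)))
    rw [← Complex.exp_eq_exp_ℂ, ← Complex.exp_add] at h
    refine (congrArg (HasSum · _) (funext fun n => ?_)).mp h
    rw [mul_pow]
    ring

/-- The integral of `exp (A cos θ + B sin θ)` over a period depends only on `A ^ 2 + B ^ 2`. -/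
theorem hasSum_integral_exp_cos_add_sin (A B : ℂ) :
    HasSum (fun n : ℕ => 2 * π * ((A ^ 2 + B ^ 2) / 4) ^ n / (n.factorial : ℂ) ^ 2)
      (∫ θ in (-π)..π, Complex.exp (A * Complex.cos θ + B * Complex.sin θ)) := by
  have hper : Function.Periodic
      (fun θ : ℝ => Complex.exp (A * Complex.cos θ + B * Complex.sin θ)) (2 * π) := by
    intro θ
    push_cast
    rw [Complex.cos_periodic, Complex.sin_periodic]
  have hshift := hper.intervalIntegral_add_eq (-π) 0
  rw [show -π + 2 * π = π by ring, zero_add] at hshift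
  rw [hshift]
  convert hasSum_integral_exp_add ((A - B * Complex.I) / 2) ((A + B * Complex.I) / 2)
    using 2 with n
  · congr 3
    linear_combination B ^ 2 / 4 * Complex.I_sq
  · ext θ
    congr 1
    rw [Complex.cos, Complex.sin, neg_mul]
    ring

/-- For reals `a, κ, γ, θc` and any complex `w` with
`w² = κ² − a² − 2·i·a·κ·cos(γ − θc)`, one has
`∫_{−π}^{π} exp(−i·a·cos(γ−θ) + κ·cos(θ−θc)) dθ = ∫_{−π}^{π} exp(w·sin t) dt`. -/
theorem stmt_8
    (a κ γ θc : ℝ) (w : ℂ)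
    (hw : w ^ 2 = (κ : ℂ) ^ 2 - (a : ℂ) ^ 2
      - 2 * Complex.I * a * κ * Real.cos (γ - θc)) :
    (∫ θ in (-π)..π,
        Complex.exp (-Complex.I * a * Real.cos (γ - θ) + κ * Real.cos (θ - θc)))
      = ∫ t in (-π)..π, Complex.exp (w * Real.sin t) := by
  have hL := hasSum_integral_exp_cos_add_sin
    (-Complex.I * a * Complex.cos γ + κ * Complex.cos θc)
    (-Complex.I * a * Complex.sin γ + κ * Complex.sin θc)
  have hR := hasSum_integral_exp_cos_add_sin 0 w
  have hAB : (-Complex.I * a * Complex.cos γ + κ * Complex.cos θc) ^ 2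
      + (-Complex.I * a * Complex.sin γ + κ * Complex.sin θc) ^ 2 = 0 ^ 2 + w ^ 2 := by
    rw [hw]
    push_cast
    rw [Complex.cos_sub]
    linear_combination (a : ℂ) ^ 2 * (Complex.sin γ ^ 2 + Complex.cos γ ^ 2) * Complex.I_sq
      - (a : ℂ) ^ 2 * Complex.sin_sq_add_cos_sq γ + (κ : ℂ) ^ 2 * Complex.sin_sq_add_cos_sq θc
  rw [hAB] at hL
  convert hL.unique hR using 3 with θ t
  · push_cast
    rw [Complex.cos_sub, Complex.cos_sub]
    ring_nf
  · simp
end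

section
/- Let N, n, m ≥ 1, let S be an m×n complex matrix with SᴴS = τ·I_n for real τ > 0, let M be an n×n Hermitian positive semidefinite matrix, let E be an N×n complex matrix, and let α ≠ 0, P > 0, σ² > 0 be reals. Set K = M + (σ²/(α²·P·τ))·I_n, W = (1/(α·√P·τ))·E·K⁻¹·Sᴴ, and C_y = α²·P·S·M·Sᴴ + σ²·I_m. Then K is invertible and W·C_y·Wᴴ = E·K⁻¹·Eᴴ. -/
open Matrix
open scoped BigOperators ComplexOrder

/-- If `SᴴS = t·I`, then compressing `a·SMSᴴ + s·I` by `S` gives `a·t²·M + s·t·I`. -/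
lemma conjTranspose_mul_covariance_mul {m n : Type*} [Fintype m] [Fintype n] [DecidableEq m]
    [DecidableEq n] {S : Matrix m n ℂ} {t : ℂ} (hS : Sᴴ * S = t • (1 : Matrix n n ℂ))
    (M : Matrix n n ℂ) (a s : ℂ) :
    Sᴴ * (a • (S * M * Sᴴ) + s • (1 : Matrix m m ℂ)) * S
      = (a * t ^ 2) • M + (s * t) • (1 : Matrix n n ℂ) := by
  have hSMS : Sᴴ * (S * M * Sᴴ) * S = t ^ 2 • M := by
    calc Sᴴ * (S * M * Sᴴ) * S = (Sᴴ * S) * M * (Sᴴ * S) := by simp only [Matrix.mul_assoc]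
      _ = t ^ 2 • M := by simp [hS, smul_smul, pow_two]
  simp [Matrix.mul_add, Matrix.add_mul, hSMS, hS, smul_smul]

/-- (Corollary 1: covariance of the LMMSE channel estimate.)
With `SᴴS = τ·I`, `M` Hermitian positive semidefinite,
`K = M + (σ²/(α²·P·τ))·I`, `W = (1/(α·√P·τ))·E·K⁻¹·Sᴴ` and
`C_y = α²·P·S·M·Sᴴ + σ²·I`, the matrix `K` is invertible and
`W·C_y·Wᴴ = E·K⁻¹·Eᴴ`. -/
theorem stmt_13
    (N n m : ℕ) (hN : 1 ≤ N) (hn : 1 ≤ n) (hm : 1 ≤ m)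
    (S : Matrix (Fin m) (Fin n) ℂ)
    (τ : ℝ) (hτ : 0 < τ)
    (hS : Sᴴ * S = (τ : ℂ) • (1 : Matrix (Fin n) (Fin n) ℂ))
    (M : Matrix (Fin n) (Fin n) ℂ) (hM : M.PosSemidef)
    (E : Matrix (Fin N) (Fin n) ℂ)
    (α P σsq : ℝ) (hα : α ≠ 0) (hP : 0 < P) (hσ : 0 < σsq)
    (K : Matrix (Fin n) (Fin n) ℂ)
    (hK : K = M + ((σsq / (α ^ 2 * P * τ) : ℝ) : ℂ) • (1 : Matrix (Fin n) (Fin n) ℂ))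
    (W : Matrix (Fin N) (Fin m) ℂ)
    (hW : W = ((1 / (α * Real.sqrt P * τ) : ℝ) : ℂ) • (E * K⁻¹ * Sᴴ))
    (Cy : Matrix (Fin m) (Fin m) ℂ)
    (hCy : Cy = ((α ^ 2 * P : ℝ) : ℂ) • (S * M * Sᴴ)
      + ((σsq : ℝ) : ℂ) • (1 : Matrix (Fin m) (Fin m) ℂ)) :
    IsUnit K ∧ W * Cy * Wᴴ = E * K⁻¹ * Eᴴ := by
  have hc : 0 < σsq / (α ^ 2 * P * τ) := by positivity
  have hKpd : K.PosDef := by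
    rw [hK]
    exact (PosDef.one.smul (Complex.zero_lt_real.mpr hc)).posSemidef_add hM
  have hdet : IsUnit K.det := (isUnit_iff_isUnit_det K).mp hKpd.isUnit
  refine ⟨hKpd.isUnit, ?_⟩
  have hSCS : Sᴴ * Cy * S = ((α ^ 2 * P * τ ^ 2 : ℝ) : ℂ) • K := by
    have hnoise : σsq * τ = α ^ 2 * P * τ ^ 2 * (σsq / (α ^ 2 * P * τ)) := by field_simp
    rw [hCy, conjTranspose_mul_covariance_mul hS, hK, smul_add, smul_smul, ← Complex.ofReal_mul,
      ← Complex.ofReal_mul, ← hnoise]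
    norm_cast
  have hscal : (1 / (α * Real.sqrt P * τ)) ^ 2 * (α ^ 2 * P * τ ^ 2) = 1 := by
    have hsqrt : Real.sqrt P ^ 2 = P := Real.sq_sqrt hP.le
    rw [div_pow, mul_pow, mul_pow, hsqrt]
    field_simp
  have hWH : Wᴴ = ((1 / (α * Real.sqrt P * τ) : ℝ) : ℂ) • (S * K⁻¹ * Eᴴ) := by
    rw [hW, conjTranspose_smul, conjTranspose_mul, conjTranspose_mul, conjTranspose_conjTranspose,
      conjTranspose_nonsing_inv, hKpd.isHermitian.eq, Matrix.mul_assoc]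
    simp
  rw [hWH, hW]
  generalize 1 / (α * Real.sqrt P * τ) = c at hscal ⊢
  calc ((c : ℂ) • (E * K⁻¹ * Sᴴ)) * Cy * ((c : ℂ) • (S * K⁻¹ * Eᴴ))
      = ((c : ℂ) ^ 2) • (E * K⁻¹ * (Sᴴ * Cy * S) * K⁻¹ * Eᴴ) := by
        simp only [Matrix.smul_mul, Matrix.mul_smul, smul_smul, Matrix.mul_assoc, pow_two]
    _ = ((c ^ 2 * (α ^ 2 * P * τ ^ 2) : ℝ) : ℂ) • (E * (K⁻¹ * K) * K⁻¹ * Eᴴ) := by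
        rw [hSCS]
        simp only [Matrix.smul_mul, Matrix.mul_smul, smul_smul, Matrix.mul_assoc]
        norm_cast
    _ = E * K⁻¹ * Eᴴ := by
        rw [hscal, nonsing_inv_mul K hdet, Matrix.mul_one, Complex.ofReal_one, one_smul]
end

section
/- Let F₁ be an n×n Hermitian positive definite complex matrix, z ∈ ℂⁿ a nonzero vector, p > 0 real, and F = F₁ + p·z·zᴴ. Then trace((F⁻¹·z·zᴴ·F⁻¹)·F₁) > 0 and trace((F⁻¹·z·zᴴ·F⁻¹)·(p·z·zᴴ)) / trace((F⁻¹·z·zᴴ·F⁻¹)·F₁) = p·zᴴ·F₁⁻¹·z. -/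
open Matrix
open scoped BigOperators ComplexOrder

namespace Matrix

theorem trace_vecMulVec_mul {n R : Type*} [Fintype n] [CommSemiring R] (u v : n → R)
    (M : Matrix n n R) : (vecMulVec u v * M).trace = v ⬝ᵥ M *ᵥ u := by
  rw [vecMulVec_mul, trace_vecMulVec, dotProduct_comm, dotProduct_mulVec]

theorem IsHermitian.mul_vecMulVec_star_mul {n R : Type*} [Fintype n] [CommSemiring R]
    [StarRing R] {A : Matrix n n R} (hA : A.IsHermitian) (z : n → R) :
    A * vecMulVec z (star z) * A = vecMulVec (A *ᵥ z) (star (A *ᵥ z)) := by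
  rw [mul_vecMulVec, vecMulVec_mul, star_mulVec, hA.eq]

/-- A rank-one update scales the solution of a linear system whose right-hand side is the
update direction. -/
theorem inv_mulVec_eq_smul_inv_add_smul_vecMulVec_mulVec {n R : Type*} [Fintype n]
    [DecidableEq n] [CommRing R] {A : Matrix n n R} (p : R) (z v : n → R) (hA : IsUnit A)
    (hB : IsUnit (A + p • vecMulVec z v)) :
    A⁻¹ *ᵥ z = (1 + p * (v ⬝ᵥ A⁻¹ *ᵥ z)) • ((A + p • vecMulVec z v)⁻¹ *ᵥ z) := by
  rw [isUnit_iff_isUnit_det] at hA hB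
  have h : (A + p • vecMulVec z v) *ᵥ (A⁻¹ *ᵥ z) = (1 + p * (v ⬝ᵥ A⁻¹ *ᵥ z)) • z := by
    rw [add_mulVec, mulVec_mulVec, mul_nonsing_inv _ hA, one_mulVec, smul_mulVec,
      vecMulVec_mulVec, op_smul_eq_smul, smul_smul, add_smul, one_smul]
  rw [← mulVec_smul, ← h, mulVec_mulVec, nonsing_inv_mul _ hB, one_mulVec]

end Matrix

/-- (Deterministic core of Theorem 1.) For `F₁` Hermitian
positive definite, `z ≠ 0`, `p > 0` and `F = F₁ + p·z·zᴴ`, setting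
`T = F⁻¹·z·zᴴ·F⁻¹`, one has `trace(T·F₁) > 0` (it is a positive real) and
`trace(T·(p·z·zᴴ)) / trace(T·F₁) = p·zᴴ·F₁⁻¹·z`. -/
theorem stmt_16
    (n : ℕ) (hn : 1 ≤ n)
    (F₁ : Matrix (Fin n) (Fin n) ℂ) (hF₁ : F₁.PosDef)
    (z : Fin n → ℂ) (hz : z ≠ 0)
    (p : ℝ) (hp : 0 < p)
    (F : Matrix (Fin n) (Fin n) ℂ)
    (hF : F = F₁ + (p : ℂ) • Matrix.vecMulVec z (star z))
    (T : Matrix (Fin n) (Fin n) ℂ)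
    (hT : T = F⁻¹ * Matrix.vecMulVec z (star z) * F⁻¹) :
    ((T * F₁).trace).im = 0
      ∧ 0 < ((T * F₁).trace).re
      ∧ (T * ((p : ℂ) • Matrix.vecMulVec z (star z))).trace / (T * F₁).trace
        = (p : ℂ) * (star z ⬝ᵥ F₁⁻¹.mulVec z) := by
  have hFpos : F.PosDef := by
    rw [hF]
    exact hF₁.add_posSemidef
      ((posSemidef_vecMulVec_self_star z).smul (Complex.zero_le_real.2 hp.le))
  set w := F⁻¹ *ᵥ z with hw_def
  set q := star z ⬝ᵥ F₁⁻¹ *ᵥ z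
  have hq : 0 < q := hF₁.inv.dotProduct_mulVec_pos hz
  have hc : 1 + (p : ℂ) * q ≠ 0 :=
    (add_pos one_pos (mul_pos (Complex.zero_lt_real.2 hp) hq)).ne'
  have hF₁z : F₁⁻¹ *ᵥ z = (1 + (p : ℂ) * q) • w := by
    rw [hw_def, hF]
    exact inv_mulVec_eq_smul_inv_add_smul_vecMulVec_mulVec (p : ℂ) z (star z) hF₁.isUnit
      (hF ▸ hFpos.isUnit)
  have hF₁w : z = (1 + (p : ℂ) * q) • (F₁ *ᵥ w) := by
    rw [← mulVec_smul, ← hF₁z, mulVec_mulVec,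
      mul_nonsing_inv _ ((isUnit_iff_isUnit_det _).1 hF₁.isUnit), one_mulVec]
  have hw : w ≠ 0 := by
    rintro h
    exact hz (by rw [hF₁w, h, mulVec_zero, smul_zero])
  have hqw : q = (1 + (p : ℂ) * q) * (star z ⬝ᵥ w) := by
    rw [← smul_eq_mul, ← dotProduct_smul, ← hF₁z]
  have hwz : star w ⬝ᵥ z = (1 + (p : ℂ) * q) * (star w ⬝ᵥ F₁ *ᵥ w) := by
    rw [← smul_eq_mul, ← dotProduct_smul, ← hF₁w]
  have htr (M : Matrix (Fin n) (Fin n) ℂ) : (T * M).trace = star w ⬝ᵥ M *ᵥ w := by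
    rw [hT, hFpos.isHermitian.inv.mul_vecMulVec_star_mul, trace_vecMulVec_mul]
  have hpos : 0 < star w ⬝ᵥ F₁ *ᵥ w := hF₁.dotProduct_mulVec_pos hw
  rw [htr, htr]
  obtain ⟨hre, him⟩ := Complex.pos_iff.1 hpos
  refine ⟨him.symm, hre, ?_⟩
  rw [div_eq_iff hpos.ne', smul_mulVec, vecMulVec_mulVec, op_smul_eq_smul, smul_smul,
    dotProduct_smul, smul_eq_mul, hwz]
  linear_combination (-(p : ℂ) * (star w ⬝ᵥ F₁ *ᵥ w)) * hqw
end
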